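/- arXiv:2604.01429 — 2 statements merged into one kernel-verified Lean document; each statement's English description precedes it below -/
import Mathlib

section
/- With Y = Σ_{j=1}^r a_j⁻¹ O_j, the single-shot estimator variance satisfies Var[ô] ≤ Σ_{j=1}^r ‖O_j‖₂² / a_j ≤ ‖O‖₂² · max_{1≤j≤r} (1/a_j), where ‖·‖₂ denotes the Frobenius (Hilbert–Schmidt) norm. -/
open Matrix
open scoped BigOperators ComplexOrder

noncomputable section

/-- Conjugation `X ↦ U X U*` as a linear endomorphism of `End(ℂ^d)`. -/
def conjMap {d : ℕ} (U : Matrix (Fin d) (Fin d) ℂ) :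
    Matrix (Fin d) (Fin d) ℂ →ₗ[ℂ] Matrix (Fin d) (Fin d) ℂ :=
  (LinearMap.mulLeft ℂ U).comp (LinearMap.mulRight ℂ (star U))

/-- The probability `p(g,i) = (1/|G|) ⟨w_i, R(g) ρ R(g)* w_i⟩` of the single-shot
outcome `(g, i)`. -/
def prob {G : Type*} [Group G] [Fintype G] {d : ℕ}
    (R : G →* Matrix.unitaryGroup (Fin d) ℂ) (w : Fin d → Fin d → ℂ)
    (ρ : Matrix (Fin d) (Fin d) ℂ) (g : G) (i : Fin d) : ℝ :=
  (((Fintype.card G : ℂ))⁻¹ *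
    ∑ x, star (w i x) *
      (((R g : Matrix (Fin d) (Fin d) ℂ) * ρ *
          star (R g : Matrix (Fin d) (Fin d) ℂ)).mulVec (w i)) x).re

/-- The single-shot estimator value `ô(g,i) = ⟨w_i, R(g) Y R(g)* w_i⟩`. -/
def est {G : Type*} [Group G] [Fintype G] {d : ℕ}
    (R : G →* Matrix.unitaryGroup (Fin d) ℂ) (w : Fin d → Fin d → ℂ)
    (Y : Matrix (Fin d) (Fin d) ℂ) (g : G) (i : Fin d) : ℝ :=
  (∑ x, star (w i x) *
      (((R g : Matrix (Fin d) (Fin d) ℂ) * Y *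
          star (R g : Matrix (Fin d) (Fin d) ℂ)).mulVec (w i)) x).re

/-- The mean `E[ô] = Σ_{g,i} p(g,i) ô(g,i)` of the single-shot estimator. -/
def mean {G : Type*} [Group G] [Fintype G] {d : ℕ}
    (R : G →* Matrix.unitaryGroup (Fin d) ℂ) (w : Fin d → Fin d → ℂ)
    (ρ Y : Matrix (Fin d) (Fin d) ℂ) : ℝ :=
  ∑ g : G, ∑ i : Fin d, prob R w ρ g i * est R w Y g i

/-- The variance `Var[ô] = Σ_{g,i} p(g,i) ô(g,i)² − (E[ô])²` of the single-shot
estimator. -/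
def variance {G : Type*} [Group G] [Fintype G] {d : ℕ}
    (R : G →* Matrix.unitaryGroup (Fin d) ℂ) (w : Fin d → Fin d → ℂ)
    (ρ Y : Matrix (Fin d) (Fin d) ℂ) : ℝ :=
  (∑ g : G, ∑ i : Fin d, prob R w ρ g i * (est R w Y g i) ^ 2) - (mean R w ρ Y) ^ 2

namespace Representation

variable {G V : Type*} [Group G] [Fintype G] [AddCommGroup V] [Module ℂ V]

theorem finrank_smul_sum_conj_of_irreducible [FiniteDimensional ℂ V] (σ : Representation ℂ G V)
    (hσ : ∀ U : Submodule ℂ V, (∀ g, ∀ v ∈ U, σ g v ∈ U) → U = ⊥ ∨ U = ⊤)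
    (T : V →ₗ[ℂ] V) (v : V) :
    (Module.finrank ℂ V : ℂ) • ∑ g, σ g⁻¹ (T (σ g v)) =
      (Fintype.card G * LinearMap.trace ℂ V T) • v := by
  rcases subsingleton_or_nontrivial V with hV | hV
  · exact Subsingleton.elim _ _
  set M : V →ₗ[ℂ] V := ∑ g, σ g⁻¹ ∘ₗ T ∘ₗ σ g with hM
  have hMv (v : V) : M v = ∑ g, σ g⁻¹ (T (σ g v)) := by simp [hM]
  have hcomm (h : G) (v : V) : M (σ h v) = σ h (M v) := by
    rw [hMv, hMv, map_sum]
    refine Fintype.sum_equiv (Equiv.mulRight h) _ _ fun g => ?_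
    have hg : σ g⁻¹ = σ h * σ (g * h)⁻¹ := by rw [← map_mul]; congr 1; group
    simp only [hg, Equiv.coe_mulRight, Module.End.mul_apply, map_mul]
  obtain ⟨c, hc⟩ := Module.End.exists_eigenvalue M
  have htop : Module.End.eigenspace M c = ⊤ := by
    refine (hσ _ fun g v hv => ?_).resolve_left hc
    rw [Module.End.mem_eigenspace_iff] at hv ⊢
    rw [hcomm, hv, map_smul]
  have hMc (v : V) : M v = c • v :=
    Module.End.mem_eigenspace_iff.mp (htop ▸ Submodule.mem_top)
  have htr : c * Module.finrank ℂ V = Fintype.card G * LinearMap.trace ℂ V T := by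
    have h1 : LinearMap.trace ℂ V M = c * Module.finrank ℂ V := by
      rw [show M = c • LinearMap.id from LinearMap.ext hMc, map_smul, LinearMap.trace_id,
        smul_eq_mul]
    have h2 (g : G) : LinearMap.trace ℂ V (σ g⁻¹ ∘ₗ T ∘ₗ σ g) = LinearMap.trace ℂ V T := by
      rw [LinearMap.trace_comp_comm', LinearMap.comp_assoc, ← Module.End.mul_eq_comp (σ g),
        ← map_mul, mul_inv_cancel, map_one]
      rfl
    rw [← h1, hM, map_sum, Finset.sum_congr rfl fun g _ => h2 g]
    simp
  rw [← hMv, hMc, smul_smul, ← htr, mul_comm]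

theorem averageMap_apply (ρ : Representation ℂ G V) [Invertible (Fintype.card G : ℂ)] (v : V) :
    ρ.averageMap v = ⅟(Fintype.card G : ℂ) • ∑ g, ρ g v := by
  simp [GroupAlgebra.average, map_sum]

theorem finrank_smul_sum_conj_averageMap [FiniteDimensional ℂ V] (ρ : Representation ℂ G V)
    (H : Subgroup G) [Fintype H] [Invertible (Fintype.card H : ℂ)] (W : Submodule ℂ V)
    (hW : ∀ g, ∀ v ∈ W, ρ g v ∈ W)
    (hirr : ∀ U ≤ W, (∀ g, ∀ v ∈ U, ρ g v ∈ U) → U = ⊥ ∨ U = W) {v : V} (hv : v ∈ W) :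
    (Module.finrank ℂ W : ℂ) • ∑ g, ρ g⁻¹ (averageMap (ρ.comp H.subtype) (ρ g v)) =
      (Fintype.card G * Module.finrank ℂ ↥(W ⊓ invariants (ρ.comp H.subtype)) : ℂ) • v := by
  set ρH : Representation ℂ H V := ρ.comp H.subtype
  have hAW : ∀ v ∈ W, ρH.averageMap v ∈ W := fun v hv => by
    rw [averageMap_apply]
    exact W.smul_mem _ (W.sum_mem fun h _ => hW _ v hv)
  set T : W →ₗ[ℂ] W := ρH.averageMap.restrict hAW
  have hT : LinearMap.IsProj (ρH.invariants.comap W.subtype) T :=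
    ⟨fun x => ρH.averageMap_invariant x, fun x hx => Subtype.ext (ρH.averageMap_id x hx)⟩
  have htr : LinearMap.trace ℂ W T = Module.finrank ℂ ↥(W ⊓ ρH.invariants) := by
    rw [hT.trace, ← Submodule.finrank_map_subtype_eq, Submodule.map_comap_subtype]
  have key := finrank_smul_sum_conj_of_irreducible (ρ.subrepresentation W fun g v hv => hW g v hv)
    (fun U hU => by
      have hmap := hirr (U.map W.subtype) (Submodule.map_subtype_le W U) (by
        rintro g _ ⟨u, hu, rfl⟩
        exact ⟨_, hU g u hu, rfl⟩)
      refine hmap.imp (fun h => ?_) fun h => ?_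
      · exact Submodule.map_injective_of_injective W.injective_subtype
          (h.trans (Submodule.map_bot _).symm)
      · exact Submodule.map_injective_of_injective W.injective_subtype
          (h.trans (Submodule.map_subtype_top W).symm)) T ⟨v, hv⟩
  have key' := congrArg W.subtype key
  rw [htr] at key'
  simp only [map_smul, map_sum] at key'
  exact key'

end Representation

section MatrixCoefficients

variable {d : ℕ}

theorem sum_norm_sq_eq_trace (A : Matrix (Fin d) (Fin d) ℂ) :
    ((∑ x, ∑ y, ‖A x y‖ ^ 2 : ℝ) : ℂ) = (Aᴴ * A).trace := by
  rw [Finset.sum_comm]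
  simp [Matrix.trace, Matrix.mul_apply, Complex.conj_mul']

theorem sum_star_mul_mulVec_eq (w : Fin d → Fin d → ℂ) (X : Matrix (Fin d) (Fin d) ℂ)
    (i j : Fin d) :
    ∑ x, star (w i x) * (X.mulVec (w j)) x = ((Matrix.of w)ᵀᴴ * X * (Matrix.of w)ᵀ) i j := by
  rw [Matrix.mul_assoc, Matrix.mul_apply]
  rfl

theorem trace_conj_unitary {U : Matrix (Fin d) (Fin d) ℂ} (hU : U * Uᴴ = 1)
    (A : Matrix (Fin d) (Fin d) ℂ) : (Uᴴ * A * U).trace = A.trace := by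
  rw [Matrix.mul_assoc, Matrix.trace_mul_comm, Matrix.mul_assoc, hU, Matrix.mul_one]

theorem conj_diag_le_trace {U ρ : Matrix (Fin d) (Fin d) ℂ} (hU : U * Uᴴ = 1)
    (hρ : ρ.PosSemidef) (i : Fin d) : ((Uᴴ * ρ * U) i i).re ≤ ρ.trace.re := by
  have hB := hρ.conjTranspose_mul_mul_same U
  rw [← trace_conj_unitary hU ρ, Matrix.trace, Complex.re_sum]
  exact Finset.single_le_sum (f := fun i => ((Uᴴ * ρ * U) i i).re)
    (fun j _ => (Complex.nonneg_iff.mp hB.diag_nonneg).1) (Finset.mem_univ i)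

variable {G : Type*} [Group G]

/-- The conjugation representation `g ↦ (X ↦ R(g) X R(g)*)` on matrices. -/
def conjRep (R : G →* Matrix.unitaryGroup (Fin d) ℂ) :
    Representation ℂ G (Matrix (Fin d) (Fin d) ℂ) where
  toFun g := conjMap (R g : Matrix (Fin d) (Fin d) ℂ)
  map_one' := by ext1 X; simp [conjMap]
  map_mul' g h := by ext1 X; simp [conjMap, Matrix.mul_assoc]

theorem conjRep_apply (R : G →* Matrix.unitaryGroup (Fin d) ℂ) (g : G)
    (X : Matrix (Fin d) (Fin d) ℂ) :
    conjRep R g X = (R g : Matrix (Fin d) (Fin d) ℂ) * X * (R g : Matrix (Fin d) (Fin d) ℂ)ᴴ := by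
  simp [conjRep, conjMap, Matrix.mul_assoc, Matrix.star_eq_conjTranspose]

theorem trace_conjTranspose_conjRep_mul (R : G →* Matrix.unitaryGroup (Fin d) ℂ) (g : G)
    (X Y : Matrix (Fin d) (Fin d) ℂ) :
    ((conjRep R g X)ᴴ * Y).trace = (Xᴴ * conjRep R g⁻¹ Y).trace := by
  have hinv : ((R g⁻¹ : Matrix.unitaryGroup (Fin d) ℂ) : Matrix (Fin d) (Fin d) ℂ) =
      (R g : Matrix (Fin d) (Fin d) ℂ)ᴴ := by
    rw [map_inv]
    rfl
  rw [conjRep_apply, conjRep_apply, hinv, Matrix.conjTranspose_mul, Matrix.conjTranspose_mul,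
    Matrix.conjTranspose_conjTranspose, Matrix.mul_assoc, Matrix.trace_mul_comm]
  simp only [Matrix.mul_assoc]

section Eigenbasis

variable {R : G →* Matrix.unitaryGroup (Fin d) ℂ} {U : Matrix (Fin d) (Fin d) ℂ}
  {H : Subgroup G} {χ : Fin d → H → ℂ}

theorem conj_conjRep_apply (hU : U * Uᴴ = 1) (hU' : Uᴴ * U = 1)
    (heig : ∀ h : H, (R (h : G) : Matrix (Fin d) (Fin d) ℂ) * U =
      U * Matrix.diagonal fun i => χ i h)
    (h : H) (X : Matrix (Fin d) (Fin d) ℂ) (i j : Fin d) :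
    (Uᴴ * conjRep R h X * U) i j = χ i h * star (χ j h) * (Uᴴ * X * U) i j := by
  have hcomm : Uᴴ * (R (h : G) : Matrix (Fin d) (Fin d) ℂ) =
      (Matrix.diagonal fun i => χ i h) * Uᴴ := by
    calc Uᴴ * (R (h : G) : Matrix (Fin d) (Fin d) ℂ)
        = Uᴴ * ((R (h : G) : Matrix (Fin d) (Fin d) ℂ) * U) * Uᴴ := by
          rw [Matrix.mul_assoc, Matrix.mul_assoc, hU, Matrix.mul_one]
      _ = _ := by rw [heig, ← Matrix.mul_assoc, hU', Matrix.one_mul]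
  have hcomm' : (R (h : G) : Matrix (Fin d) (Fin d) ℂ)ᴴ * U =
      U * (Matrix.diagonal fun i => star (χ i h)) := by
    simpa [Matrix.conjTranspose_mul, Matrix.diagonal_conjTranspose, Pi.star_def]
      using congrArg Matrix.conjTranspose hcomm
  have : Uᴴ * conjRep R h X * U = (Matrix.diagonal fun i => χ i h) * (Uᴴ * X * U) *
      (Matrix.diagonal fun i => star (χ i h)) := by
    rw [conjRep_apply]
    simp only [← Matrix.mul_assoc]
    rw [hcomm]
    simp only [Matrix.mul_assoc]
    rw [hcomm']
  rw [this, Matrix.mul_diagonal, Matrix.diagonal_mul]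
  ring

theorem eigenvalue_mul_star (hU : U * Uᴴ = 1) (hU' : Uᴴ * U = 1)
    (heig : ∀ h : H, (R (h : G) : Matrix (Fin d) (Fin d) ℂ) * U =
      U * Matrix.diagonal fun i => χ i h)
    (h : H) (i : Fin d) : χ i h * star (χ i h) = 1 := by
  have h1 : conjRep R (h : G) 1 = 1 := by
    rw [conjRep_apply, Matrix.mul_one]
    exact Matrix.mem_unitaryGroup_iff.mp (R (h : G)).2
  have := conj_conjRep_apply hU hU' heig h 1 i i
  rw [h1, Matrix.mul_one, hU', Matrix.one_apply_eq, mul_one] at this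
  exact this.symm

variable [Fintype H] [Invertible (Fintype.card H : ℂ)]

theorem conj_averageMap_eq_diagonal (hU : U * Uᴴ = 1) (hU' : Uᴴ * U = 1)
    (heig : ∀ h : H, (R (h : G) : Matrix (Fin d) (Fin d) ℂ) * U =
      U * Matrix.diagonal fun i => χ i h)
    (X : Matrix (Fin d) (Fin d) ℂ)
    (hX : ∀ i j, i ≠ j → χ i = χ j → (Uᴴ * X * U) i j = 0) :
    Uᴴ * Representation.averageMap ((conjRep R).comp H.subtype) X * U =
      Matrix.diagonal fun i => (Uᴴ * X * U) i i := by
  set A := Representation.averageMap ((conjRep R).comp H.subtype) X with hA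
  have hsum (i j : Fin d) : (Uᴴ * A * U) i j =
      ⅟(Fintype.card H : ℂ) * ∑ h : H, χ i h * star (χ j h) * (Uᴴ * X * U) i j := by
    rw [hA, Representation.averageMap_apply]
    simp only [Matrix.mul_smul, Matrix.smul_mul, Matrix.mul_sum, Matrix.sum_mul,
      Matrix.smul_apply, Matrix.sum_apply, smul_eq_mul]
    congr 1
    exact Finset.sum_congr rfl fun h _ => conj_conjRep_apply hU hU' heig h X i j
  ext i j
  rcases eq_or_ne i j with rfl | hij
  · rw [hsum, Matrix.diagonal_apply_eq]
    simp only [eigenvalue_mul_star hU hU' heig, one_mul, Finset.sum_const, Finset.card_univ,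
      nsmul_eq_mul, invOf_mul_cancel_left']
  rw [Matrix.diagonal_apply_ne _ hij]
  by_cases hχ : χ i = χ j
  · simp [hsum, hX i j hij hχ]
  by_contra hne
  refine hχ (funext fun h => ?_)
  have hinv : conjRep R (h : G) A = A :=
    Representation.averageMap_invariant ((conjRep R).comp H.subtype) X h
  have hfix := conj_conjRep_apply hU hU' heig h A i j
  rw [hinv] at hfix
  have hone : χ i h * star (χ j h) = 1 := by
    refine mul_right_cancel₀ hne ?_
    rw [← hfix, one_mul]
  calc χ i h = χ i h * (χ j h * star (χ j h)) := by
        rw [eigenvalue_mul_star hU hU' heig, mul_one]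
    _ = χ j h * (χ i h * star (χ j h)) := by ring
    _ = χ j h := by rw [hone, mul_one]

theorem trace_mul_averageMap (hU : U * Uᴴ = 1) (hU' : Uᴴ * U = 1)
    (heig : ∀ h : H, (R (h : G) : Matrix (Fin d) (Fin d) ℂ) * U =
      U * Matrix.diagonal fun i => χ i h)
    (X : Matrix (Fin d) (Fin d) ℂ)
    (hX : ∀ i j, i ≠ j → χ i = χ j → (Uᴴ * X * U) i j = 0) :
    (Xᴴ * Representation.averageMap ((conjRep R).comp H.subtype) X).trace =
      ((∑ i, ‖(Uᴴ * X * U) i i‖ ^ 2 : ℝ) : ℂ) := by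
  set A := Representation.averageMap ((conjRep R).comp H.subtype) X with hA
  have hprod : Uᴴ * (Xᴴ * A) * U = (Uᴴ * X * U)ᴴ * (Uᴴ * A * U) := by
    calc Uᴴ * (Xᴴ * A) * U = Uᴴ * Xᴴ * (U * Uᴴ) * A * U := by
          rw [hU]; simp only [Matrix.mul_one, Matrix.mul_assoc]
      _ = _ := by
          simp only [Matrix.conjTranspose_mul, Matrix.conjTranspose_conjTranspose,
            Matrix.mul_assoc]
  rw [← trace_conj_unitary hU, hprod, conj_averageMap_eq_diagonal hU hU' heig X hX, Matrix.trace]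
  simp only [Matrix.diag_apply, Matrix.mul_diagonal, Matrix.conjTranspose_apply]
  push_cast
  exact Finset.sum_congr rfl fun i _ => Complex.conj_mul' _

end Eigenbasis

end MatrixCoefficients

section Variance

variable {G : Type*} [Group G] [Fintype G] {d : ℕ}

theorem variance_le_average_sq (R : G →* Matrix.unitaryGroup (Fin d) ℂ) (w : Fin d → Fin d → ℂ)
    (hU : (Matrix.of w)ᵀ * (Matrix.of w)ᵀᴴ = 1) {ρ : Matrix (Fin d) (Fin d) ℂ}
    (hρ : ρ.PosSemidef) (hρtr : ρ.trace = 1) (Y : Matrix (Fin d) (Fin d) ℂ) :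
    variance R w ρ Y ≤ (Fintype.card G : ℝ)⁻¹ *
      ∑ g, ∑ i, ‖((Matrix.of w)ᵀᴴ * conjRep R g Y * (Matrix.of w)ᵀ) i i‖ ^ 2 := by
  refine (sub_le_self _ (sq_nonneg _)).trans ?_
  rw [Finset.mul_sum]
  refine Finset.sum_le_sum fun g _ => ?_
  rw [Finset.mul_sum]
  refine Finset.sum_le_sum fun i _ => ?_
  have hprob : prob R w ρ g i ≤ (Fintype.card G : ℝ)⁻¹ := by
    have hpos : (conjRep R g ρ).PosSemidef := by
      rw [conjRep_apply]
      exact hρ.mul_mul_conjTranspose_same _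
    have htr : (conjRep R g ρ).trace = 1 := by
      rw [conjRep_apply, Matrix.trace_mul_cycle,
        show (R g : Matrix (Fin d) (Fin d) ℂ)ᴴ * (R g : Matrix (Fin d) (Fin d) ℂ) = 1 from
          Matrix.mem_unitaryGroup_iff'.mp (R g).2, Matrix.one_mul, hρtr]
    have hle := conj_diag_le_trace hU hpos i
    rw [htr, Complex.one_re] at hle
    rw [prob, sum_star_mul_mulVec_eq, Matrix.star_eq_conjTranspose, ← conjRep_apply,
      ← Complex.ofReal_natCast, ← Complex.ofReal_inv, Complex.re_ofReal_mul]
    exact mul_le_of_le_one_right (by positivity) hle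
  have hest : est R w Y g i ^ 2 ≤
      ‖((Matrix.of w)ᵀᴴ * conjRep R g Y * (Matrix.of w)ᵀ) i i‖ ^ 2 := by
    rw [est, sum_star_mul_mulVec_eq, Matrix.star_eq_conjTranspose, ← conjRep_apply, sq_le_sq,
      abs_norm]
    exact Complex.abs_re_le_norm _
  exact mul_le_mul hprob hest (sq_nonneg _) (by positivity)

end Variance

theorem trace_sum_smul_mul_sum {d r : ℕ} (O : Fin r → Matrix (Fin d) (Fin d) ℂ)
    (horth : ∀ j j', j ≠ j' → ((O j)ᴴ * O j').trace = 0) (c : Fin r → ℝ) :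
    ((∑ j, (c j : ℂ) • O j)ᴴ * ∑ j, O j).trace =
      ((∑ j, c j * ∑ x, ∑ y, ‖O j x y‖ ^ 2 : ℝ) : ℂ) := by
  rw [Matrix.conjTranspose_sum, Matrix.sum_mul, Matrix.trace_sum, Complex.ofReal_sum]
  refine Finset.sum_congr rfl fun j _ => ?_
  rw [Matrix.conjTranspose_smul, Matrix.smul_mul, Matrix.trace_smul, Matrix.mul_sum,
    Matrix.trace_sum, Finset.sum_eq_single j (fun j' _ hj' => horth j j' hj'.symm) (by simp),
    ← sum_norm_sq_eq_trace]
  simp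

/-- In the NDCSE setting, with `O = Σ_j O_j` supported on pairwise
Hilbert–Schmidt-orthogonal visible irreducible subspaces `W_j` with visibility
coefficients `a_j > 0`, the single-shot estimator built from `Y = Σ_j a_j⁻¹ O_j`
satisfies `Var[ô] ≤ Σ_j ‖O_j‖₂²/a_j ≤ ‖O‖₂² · max_j a_j⁻¹`
(`‖·‖₂` the Frobenius norm). -/
theorem shadow_variance_frobenius_bound
    (G : Type*) [Group G] [Fintype G] (d m : ℕ)
    (R : G →* Matrix.unitaryGroup (Fin d) ℂ)
    -- the orthogonal projections onto the summands V_1, ..., V_m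
    (P : Fin m → Matrix (Fin d) (Fin d) ℂ)
    (hPproj : ∀ k, P k * P k = P k)
    (hPsa : ∀ k, (P k)ᴴ = P k)
    (hPorth : ∀ k l, k ≠ l → P k * P l = 0)
    (hPsum : ∑ k, P k = 1)
    (hPinv : ∀ (g : G) k, (R g : Matrix (Fin d) (Fin d) ℂ) * P k
        = P k * (R g : Matrix (Fin d) (Fin d) ℂ))
    -- each summand is irreducible as a G-module
    (hirr : ∀ k (Q : Matrix (Fin d) (Fin d) ℂ), Q * Q = Q → Qᴴ = Q →
        Q * P k = Q → P k * Q = Q →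
        (∀ g : G, (R g : Matrix (Fin d) (Fin d) ℂ) * Q
          = Q * (R g : Matrix (Fin d) (Fin d) ℂ)) →
        Q = 0 ∨ Q = P k)
    -- an orthonormal basis adapted to the decomposition
    (w : Fin d → Fin d → ℂ)
    (horth : ∀ i j, (∑ x, star (w i x) * w j x) = if i = j then 1 else 0)
    (k : Fin d → Fin m)
    (hadapt : ∀ i, (P (k i)).mulVec (w i) = w i)
    -- an abelian subgroup H of G for which w is a non-degenerate simultaneous eigenbasis
    (H : Subgroup G)
    (hHab : ∀ a b : H, a * b = b * a)
    (χ : Fin d → H → ℂ)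
    (heig : ∀ (h : H) (i : Fin d),
      ((R (h : G) : Matrix (Fin d) (Fin d) ℂ)).mulVec (w i) = χ i h • w i)
    (hnd : ∀ i j, i ≠ j → k i = k j → χ i ≠ χ j)
    -- the target observable O = Σ_j O_j with O_j in conjugation-invariant irreducible
    -- block-preserving subspaces W_j
    (r : ℕ)
    (Oj : Fin r → Matrix (Fin d) (Fin d) ℂ)
    (W : Fin r → Submodule ℂ (Matrix (Fin d) (Fin d) ℂ))
    (hWinv : ∀ j (g : G), ∀ X ∈ W j, conjMap (R g : Matrix (Fin d) (Fin d) ℂ) X ∈ W j)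
    (hWirr : ∀ j (W' : Submodule ℂ (Matrix (Fin d) (Fin d) ℂ)), W' ≤ W j →
      (∀ (g : G), ∀ X ∈ W', conjMap (R g : Matrix (Fin d) (Fin d) ℂ) X ∈ W') →
      W' = ⊥ ∨ W' = W j)
    (hWdiag : ∀ j, ∀ X ∈ W j, ∀ l, P l * X * P l = X * P l)
    (hOmem : ∀ j, Oj j ∈ W j)
    (hOne : ∀ j, Oj j ≠ 0)
    (hOsa : ∀ j, (Oj j)ᴴ = Oj j)
    -- the visibility coefficients a_j = dim (W_j)^H / dim W_j, all positive
    (a : Fin r → ℝ)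
    (ha : ∀ j, a j =
      (Module.finrank ℂ
        ↥(W j ⊓ ⨅ h : H, LinearMap.ker
            (conjMap ((R (h : G) : Matrix (Fin d) (Fin d) ℂ)) - LinearMap.id)) : ℝ) /
      (Module.finrank ℂ ↥(W j) : ℝ))
    (hapos : ∀ j, 0 < a j)
    -- a density matrix
    (ρ : Matrix (Fin d) (Fin d) ℂ)
    (hρ : ρ.PosSemidef) (hρtr : ρ.trace = 1)
    -- the subspaces W_j are pairwise orthogonal in the Hilbert–Schmidt inner product
    (horthW : ∀ j j', j ≠ j' → ∀ X ∈ W j, ∀ Y ∈ W j', (Xᴴ * Y).trace = 0)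
    (hr : 0 < r) :
    variance R w ρ (∑ j, ((a j : ℂ))⁻¹ • Oj j)
        ≤ ∑ j, (∑ x, ∑ y, ‖Oj j x y‖ ^ 2) / a j ∧
    (∑ j, (∑ x, ∑ y, ‖Oj j x y‖ ^ 2) / a j)
        ≤ (∑ x, ∑ y, ‖(∑ j, Oj j) x y‖ ^ 2) *
          (Finset.univ.sup' (Finset.univ_nonempty_iff.mpr (Fin.pos_iff_nonempty.mp hr))
            fun j => (a j)⁻¹) := by
  classical
  let _ : Fintype H := Fintype.ofFinite H
  let _ : Invertible (Fintype.card H : ℂ) :=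
    invertibleOfNonzero (Nat.cast_ne_zero.mpr Fintype.card_ne_zero)
  set U : Matrix (Fin d) (Fin d) ℂ := (Matrix.of w)ᵀ
  have hU' : Uᴴ * U = 1 := by
    ext i j
    rw [Matrix.one_apply, ← horth i j]
    rfl
  have hU : U * Uᴴ = 1 := mul_eq_one_comm.mp hU'
  have heigU (h : H) : (R (h : G) : Matrix (Fin d) (Fin d) ℂ) * U =
      U * Matrix.diagonal fun i => χ i h := by
    ext x i
    rw [Matrix.mul_diagonal, mul_comm]
    exact congrFun (heig h i) x
  have horthO (j j' : Fin r) (hj : j ≠ j') : ((Oj j)ᴴ * Oj j').trace = 0 :=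
    horthW j j' hj _ (hOmem j) _ (hOmem j')
  set Y : Matrix (Fin d) (Fin d) ℂ := ∑ j, ((a j : ℂ))⁻¹ • Oj j with hY
  have hblock (g : G) (l : Fin m) : P l * conjRep R g Y * P l = conjRep R g Y * P l := by
    have (j : Fin r) : P l * conjRep R g (Oj j) * P l = conjRep R g (Oj j) * P l :=
      hWdiag j _ (hWinv j g _ (hOmem j)) l
    simp [hY, map_sum, Matrix.mul_sum, Matrix.sum_mul, this]
  have hoff (g : G) (i j : Fin d) (hij : i ≠ j) (hχ : χ i = χ j) :
      (Uᴴ * conjRep R g Y * U) i j = 0 := by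
    have hk : k j ≠ k i := fun h => hnd i j hij h.symm hχ
    have hzero : (P (k j)).mulVec (w i) = 0 := by
      rw [← hadapt i, Matrix.mulVec_mulVec, hPorth _ _ hk, Matrix.zero_mulVec]
    rw [← sum_star_mul_mulVec_eq]
    change star (w i) ⬝ᵥ _ = 0
    rw [← hadapt j, Matrix.mulVec_mulVec, ← hblock, Matrix.mul_assoc, ← Matrix.mulVec_mulVec,
      Matrix.dotProduct_mulVec, ← hPsa (k j), ← Matrix.star_mulVec, hzero, star_zero,
      zero_dotProduct]
  have hmul (j : Fin r) :
      ∑ g, conjRep R g⁻¹ (Representation.averageMap ((conjRep R).comp H.subtype)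
        (conjRep R g (Oj j))) = (Fintype.card G * (a j : ℂ)) • Oj j := by
    have key := Representation.finrank_smul_sum_conj_averageMap (conjRep R) H (W j)
      (hWinv j) (hWirr j) (hOmem j)
    have hinf : Representation.invariants ((conjRep R).comp H.subtype) = ⨅ h : H, LinearMap.ker
        (conjMap ((R (h : G) : Matrix (Fin d) (Fin d) ℂ)) - LinearMap.id) := by
      ext X
      simp only [Representation.mem_invariants, Submodule.mem_iInf, LinearMap.mem_ker,
        LinearMap.sub_apply, LinearMap.id_apply, sub_eq_zero]
      rfl
    have hne : (Module.finrank ℂ (W j) : ℂ) ≠ 0 := fun h0 => by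
      have := hapos j
      rw [ha j, Nat.cast_eq_zero.mp h0] at this
      simp at this
    rw [hinf] at key
    refine smul_right_injective _ hne (key.trans ?_)
    change _ = (Module.finrank ℂ (W j) : ℂ) • _
    rw [smul_smul, ha j]
    push_cast
    congr 1
    field_simp
  have hsumY : ∑ g, conjRep R g⁻¹ (Representation.averageMap ((conjRep R).comp H.subtype)
      (conjRep R g Y)) = (Fintype.card G : ℂ) • ∑ j, Oj j := by
    simp only [hY, map_sum, map_smul]
    rw [Finset.sum_comm, Finset.smul_sum]
    refine Finset.sum_congr rfl fun j _ => ?_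
    have : (a j : ℂ) ≠ 0 := Complex.ofReal_ne_zero.mpr (hapos j).ne'
    rw [← Finset.smul_sum, hmul, smul_smul]
    congr 1
    field_simp
  have hquad : ∑ g, ∑ i, ‖(Uᴴ * conjRep R g Y * U) i i‖ ^ 2 =
      Fintype.card G * ∑ j, (a j)⁻¹ * ∑ x, ∑ y, ‖Oj j x y‖ ^ 2 := by
    apply Complex.ofReal_injective
    rw [Complex.ofReal_sum, Complex.ofReal_mul,
      ← trace_sum_smul_mul_sum Oj horthO fun j => (a j)⁻¹]
    simp only [← trace_mul_averageMap hU hU' heigU _ (hoff _), trace_conjTranspose_conjRep_mul]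
    rw [← Matrix.trace_sum, ← Matrix.mul_sum, hsumY, Matrix.mul_smul, Matrix.trace_smul]
    simp [hY]
  constructor
  · refine (variance_le_average_sq R w hU hρ hρtr Y).trans_eq ?_
    have : (Fintype.card G : ℝ) ≠ 0 := Nat.cast_ne_zero.mpr Fintype.card_ne_zero
    rw [hquad, inv_mul_cancel_left₀ this]
    simp only [div_eq_inv_mul]
  · have hpyth : ∑ x, ∑ y, ‖(∑ j, Oj j) x y‖ ^ 2 = ∑ j, ∑ x, ∑ y, ‖Oj j x y‖ ^ 2 := by
      apply Complex.ofReal_injective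
      rw [sum_norm_sq_eq_trace]
      simpa using trace_sum_smul_mul_sum Oj horthO fun _ => 1
    rw [hpyth, Finset.sum_mul]
    refine Finset.sum_le_sum fun j _ => ?_
    rw [div_eq_mul_inv]
    exact mul_le_mul_of_nonneg_left
      (Finset.le_sup' (fun j => (a j)⁻¹) (Finset.mem_univ j)) (by positivity)
end
end

section
/- Let W ⊆ End(V) be invariant and irreducible under the conjugation action X ↦ R(g) X R(g)*, with every element of W mapping each V_k into itself and a := dim(W^H)/dim(W) > 0. If O ∈ W is positive semidefinite or negative semidefinite, then the estimator with Y = a⁻¹ O satisfies Var[ô] ≤ ‖O‖_∞² / a for every density matrix ρ, where ‖·‖_∞ is the operator norm. -/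
open Matrix
open scoped BigOperators ComplexOrder

noncomputable section

/-- The operator (spectral) norm `‖·‖_∞` of a matrix, i.e. the norm of the induced
continuous linear map on the euclidean space `ℂ^d`. -/
def opNorm {d : ℕ} (A : Matrix (Fin d) (Fin d) ℂ) : ℝ :=
  ‖Matrix.toEuclideanCLM (𝕜 := ℂ) A‖

theorem exists_scalar_of_irreducible {ι V : Type*} [AddCommGroup V] [Module ℂ V]
    [FiniteDimensional ℂ V] (W : Submodule ℂ V) (hW : W ≠ ⊥) (φ : ι → V →ₗ[ℂ] V)
    (hφ : ∀ g, ∀ x ∈ W, φ g x ∈ W)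
    (hirr : ∀ W' : Submodule ℂ V, W' ≤ W → (∀ g, ∀ x ∈ W', φ g x ∈ W') → W' = ⊥ ∨ W' = W)
    (T : V →ₗ[ℂ] V) (hT : ∀ x ∈ W, T x ∈ W)
    (hcomm : ∀ g, ∀ x ∈ W, T (φ g x) = φ g (T x)) :
    ∃ c : ℂ, ∀ x ∈ W, T x = c • x := by
  have : Nontrivial W := Submodule.nontrivial_iff_ne_bot.2 hW
  obtain ⟨c, hc⟩ := Module.End.exists_eigenvalue (T.restrict hT)
  obtain ⟨v, hv⟩ := hc.exists_hasEigenvector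
  refine ⟨c, ?_⟩
  have hmem : ∀ x, x ∈ W ⊓ LinearMap.ker (T - c • LinearMap.id) ↔ x ∈ W ∧ T x = c • x := by
    intro x; simp [sub_eq_zero]
  rcases hirr (W ⊓ LinearMap.ker (T - c • LinearMap.id)) inf_le_left (by
    intro g x hx
    rw [hmem] at hx ⊢
    exact ⟨hφ g x hx.1, by rw [hcomm g x hx.1, hx.2, map_smul]⟩) with h | h
  · refine absurd ?_ hv.2
    have : (v : V) ∈ W ⊓ LinearMap.ker (T - c • LinearMap.id) :=
      (hmem _).2 ⟨v.2, congrArg Subtype.val hv.apply_eq_smul⟩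
    rw [h] at this
    exact Subtype.ext (by simpa using this)
  · intro x hx
    rw [← h] at hx
    exact ((hmem x).1 hx).2

theorem trace_restrict_of_isProj {V : Type*} [AddCommGroup V] [Module ℂ V]
    [FiniteDimensional ℂ V] (W F : Submodule ℂ V) (D : V →ₗ[ℂ] V)
    (hD : ∀ x ∈ W, D x ∈ W ⊓ F) (hDfix : ∀ x ∈ W ⊓ F, D x = x) :
    LinearMap.trace ℂ W (D.restrict fun x hx => (hD x hx).1) =
      Module.finrank ℂ ↥(W ⊓ F) := by
  have hproj : LinearMap.IsProj ((W ⊓ F).comap W.subtype)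
      (D.restrict fun x hx => (hD x hx).1) :=
    ⟨fun x => hD x x.2, fun x hx => Subtype.ext (hDfix x hx)⟩
  rw [hproj.trace, (Submodule.comapSubtypeEquivOfLe inf_le_left).finrank_eq]

theorem posSemidef_opNorm_smul_one_sub {d : ℕ} {A : Matrix (Fin d) (Fin d) ℂ}
    (hA : A.IsHermitian) : ((opNorm A : ℂ) • (1 : Matrix (Fin d) (Fin d) ℂ) - A).PosSemidef := by
  open scoped Matrix.Norms.L2Operator MatrixOrder in
  have h := IsSelfAdjoint.le_algebraMap_norm_self (a := A) hA
  have h2 := Matrix.le_iff.1 h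
  have e : algebraMap ℝ (Matrix (Fin d) (Fin d) ℂ) (opNorm A) = (opNorm A : ℂ) • 1 := by
    rw [Algebra.algebraMap_eq_smul_one]; ext i j; simp
  rw [← e]
  exact h2

theorem trace_mul_nonneg_of_posSemidef {d : ℕ} {A B : Matrix (Fin d) (Fin d) ℂ}
    (hA : A.PosSemidef) (hB : B.PosSemidef) : 0 ≤ (A * B).trace := by
  open scoped Matrix.Norms.L2Operator MatrixOrder in
  obtain ⟨C, rfl⟩ := CStarAlgebra.nonneg_iff_eq_star_mul_self.1 hA.nonneg
  rw [star_eq_conjTranspose, Matrix.mul_assoc, Matrix.trace_mul_comm]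
  exact (hB.mul_mul_conjTranspose_same C).trace_nonneg

theorem conjMap_apply {d : ℕ} (A X : Matrix (Fin d) (Fin d) ℂ) :
    conjMap A X = A * X * star A := by
  simp [conjMap, mul_assoc]

theorem conjMap_conjMap {d : ℕ} (A B X : Matrix (Fin d) (Fin d) ℂ) :
    conjMap A (conjMap B X) = conjMap (A * B) X := by
  simp [conjMap_apply, mul_assoc]

theorem conjMap_one {d : ℕ} (X : Matrix (Fin d) (Fin d) ℂ) : conjMap 1 X = X := by
  simp [conjMap_apply]

/-- The rank-one operator `|v⟩⟨v|`. -/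
def rankOne {d : ℕ} (v : Fin d → ℂ) : Matrix (Fin d) (Fin d) ℂ := vecMulVec v (star v)

theorem star_rankOne {d : ℕ} (v : Fin d → ℂ) : star (rankOne v) = rankOne v := by
  ext i j
  simp [rankOne, vecMulVec_apply, Matrix.star_apply, mul_comm]

theorem rankOne_mul_mul_rankOne {d : ℕ} (v : Fin d → ℂ) (X : Matrix (Fin d) (Fin d) ℂ) :
    rankOne v * X * rankOne v = (star v ⬝ᵥ X *ᵥ v) • rankOne v := by
  rw [rankOne, mul_assoc, mul_vecMulVec, vecMulVec_mul_vecMulVec, vecMulVec_smul]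

theorem trace_mul_rankOne {d : ℕ} (v : Fin d → ℂ) (X : Matrix (Fin d) (Fin d) ℂ) :
    (X * rankOne v).trace = star v ⬝ᵥ X *ᵥ v := by
  rw [rankOne, mul_vecMulVec, trace_vecMulVec, dotProduct_comm]

theorem mul_rankOne_of_mulVec_eq {d : ℕ} {v : Fin d → ℂ} {A : Matrix (Fin d) (Fin d) ℂ} {c : ℂ}
    (h : A *ᵥ v = c • v) : A * rankOne v = c • rankOne v := by
  rw [rankOne, mul_vecMulVec, h, smul_vecMulVec]

theorem sum_rankOne {d : ℕ} {w : Fin d → Fin d → ℂ}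
    (horth : ∀ i j, (∑ x, star (w i x) * w j x) = if i = j then 1 else 0) :
    ∑ i, rankOne (w i) = 1 := by
  have h : (Matrix.of w).map star * (Matrix.of w)ᵀ = 1 := by
    ext i j
    simpa [Matrix.mul_apply, Matrix.one_apply] using horth i j
  have h' := mul_eq_one_comm.1 h
  ext x y
  simpa [Matrix.sum_apply, rankOne, vecMulVec_apply, Matrix.mul_apply] using
    congrFun (congrFun h' x) y

theorem rankOne_mul_rankOne {d : ℕ} {w : Fin d → Fin d → ℂ}
    (horth : ∀ i j, (∑ x, star (w i x) * w j x) = if i = j then 1 else 0) (i j : Fin d) :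
    rankOne (w i) * rankOne (w j) = if i = j then rankOne (w i) else 0 := by
  have h : star (w i) ⬝ᵥ w j = if i = j then 1 else 0 := horth i j
  rw [rankOne, rankOne, vecMulVec_mul_vecMulVec, h]
  split_ifs with hij
  · simp [hij]
  · simp

theorem rankOne_mul_of_eigenbasis {d : ℕ} {w : Fin d → Fin d → ℂ}
    (horth : ∀ i j, (∑ x, star (w i x) * w j x) = if i = j then 1 else 0)
    {A : Matrix (Fin d) (Fin d) ℂ} {c : Fin d → ℂ} (h : ∀ i, A *ᵥ w i = c i • w i) (i : Fin d) :
    rankOne (w i) * A = c i • rankOne (w i) := by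
  have hA : A = ∑ j, c j • rankOne (w j) := by
    rw [← mul_one A, ← sum_rankOne horth, Finset.mul_sum]
    exact Finset.sum_congr rfl fun j _ => mul_rankOne_of_mulVec_eq (h j)
  rw [hA, Finset.mul_sum]
  simp [rankOne_mul_rankOne horth]

/-- The dephasing map `X ↦ ∑ i, |w i⟩⟨w i| X |w i⟩⟨w i|`. -/
def dephase {d : ℕ} (w : Fin d → Fin d → ℂ) :
    Matrix (Fin d) (Fin d) ℂ →ₗ[ℂ] Matrix (Fin d) (Fin d) ℂ :=
  ∑ i, conjMap (rankOne (w i))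

theorem dephase_apply {d : ℕ} (w : Fin d → Fin d → ℂ) (X : Matrix (Fin d) (Fin d) ℂ) :
    dephase w X = ∑ i, rankOne (w i) * X * rankOne (w i) := by
  simp [dephase, conjMap_apply, star_rankOne]

theorem dephase_eq_self {d : ℕ} {w : Fin d → Fin d → ℂ}
    (horth : ∀ i j, (∑ x, star (w i x) * w j x) = if i = j then 1 else 0)
    {X : Matrix (Fin d) (Fin d) ℂ}
    (hX : ∀ i j, i ≠ j → rankOne (w i) * X * rankOne (w j) = 0) : dephase w X = X := by
  have h : X = (∑ i, rankOne (w i)) * X * ∑ i, rankOne (w i) := by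
    simp [sum_rankOne horth]
  conv_rhs => rw [h]
  rw [dephase_apply, Finset.sum_mul, Finset.sum_mul]
  refine Finset.sum_congr rfl fun i _ => ?_
  rw [Finset.mul_sum, Finset.sum_eq_single i (fun j _ hj => hX i j hj.symm) (by simp)]

theorem dephase_conjMap_of_eigenbasis {d : ℕ} {w : Fin d → Fin d → ℂ}
    (horth : ∀ i j, (∑ x, star (w i x) * w j x) = if i = j then 1 else 0)
    {A : Matrix (Fin d) (Fin d) ℂ} (hA : A * star A = 1)
    {c : Fin d → ℂ} (h : ∀ i, A *ᵥ w i = c i • w i) (X : Matrix (Fin d) (Fin d) ℂ) :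
    dephase w (conjMap A X) = dephase w X := by
  rw [dephase_apply, dephase_apply]
  refine Finset.sum_congr rfl fun i _ => ?_
  have h1 := rankOne_mul_of_eigenbasis horth h i
  have h2 : star A * rankOne (w i) = star (c i) • rankOne (w i) := by
    simpa [star_rankOne] using congrArg star h1
  have h3 : (c i * star (c i)) • rankOne (w i) = rankOne (w i) := by
    have : rankOne (w i) * (A * star A) * rankOne (w i) = rankOne (w i) := by
      simp [hA, rankOne_mul_rankOne horth]
    calc _ = (rankOne (w i) * A) * (star A * rankOne (w i)) := by
          rw [h1, h2, smul_mul_smul_comm, rankOne_mul_rankOne horth, if_pos rfl]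
      _ = _ := by simpa only [mul_assoc] using this
  calc _ = (rankOne (w i) * A) * X * (star A * rankOne (w i)) := by
        rw [conjMap_apply]; simp only [mul_assoc]
    _ = ((c i * star (c i)) • rankOne (w i)) * X * rankOne (w i) := by
        rw [h1, h2]; simp only [smul_mul_assoc, mul_smul_comm, smul_smul, mul_comm]
    _ = _ := by rw [h3]

section Twirl

variable {G : Type*} [Group G] {d : ℕ} (R : G →* Matrix.unitaryGroup (Fin d) ℂ)

theorem star_rep_coe (g : G) :
    star (R g : Matrix (Fin d) (Fin d) ℂ) = (R g⁻¹ : Matrix (Fin d) (Fin d) ℂ) := by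
  rw [map_inv]; rfl

theorem rep_coe_mul_rep_coe (g h : G) :
    (R g : Matrix (Fin d) (Fin d) ℂ) * (R h : Matrix (Fin d) (Fin d) ℂ) =
      (R (g * h) : Matrix (Fin d) (Fin d) ℂ) := by
  rw [map_mul]; rfl

theorem conjMap_rep_conjMap_rep (g h : G) (X : Matrix (Fin d) (Fin d) ℂ) :
    conjMap (R g : Matrix (Fin d) (Fin d) ℂ) (conjMap (R h : Matrix (Fin d) (Fin d) ℂ) X) =
      conjMap (R (g * h) : Matrix (Fin d) (Fin d) ℂ) X := by
  rw [conjMap_conjMap, rep_coe_mul_rep_coe]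

variable [Fintype G] (w : Fin d → Fin d → ℂ)

/-- The unnormalized measurement channel
`X ↦ ∑ g, R(g)* D(R(g) X R(g)*) R(g)`, where `D` is the dephasing map. -/
def twirl : Matrix (Fin d) (Fin d) ℂ →ₗ[ℂ] Matrix (Fin d) (Fin d) ℂ :=
  ∑ g : G, conjMap (R g⁻¹ : Matrix (Fin d) (Fin d) ℂ) ∘ₗ dephase w ∘ₗ
    conjMap (R g : Matrix (Fin d) (Fin d) ℂ)

theorem twirl_apply (X : Matrix (Fin d) (Fin d) ℂ) :
    twirl R w X = ∑ g : G, conjMap (R g⁻¹ : Matrix (Fin d) (Fin d) ℂ)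
      (dephase w (conjMap (R g : Matrix (Fin d) (Fin d) ℂ) X)) := by
  simp [twirl]

theorem twirl_conjMap (h : G) (X : Matrix (Fin d) (Fin d) ℂ) :
    twirl R w (conjMap (R h : Matrix (Fin d) (Fin d) ℂ) X) =
      conjMap (R h : Matrix (Fin d) (Fin d) ℂ) (twirl R w X) := by
  rw [twirl_apply, twirl_apply, map_sum]
  refine Fintype.sum_equiv (Equiv.mulRight h) _ _ fun g => ?_
  simp only [Equiv.coe_mulRight, conjMap_rep_conjMap_rep, _root_.mul_inv_rev, mul_inv_cancel_left]

theorem trace_mul_twirl (ρ X : Matrix (Fin d) (Fin d) ℂ) :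
    (ρ * twirl R w X).trace = ∑ g : G, ∑ i,
      (star (w i) ⬝ᵥ conjMap (R g : Matrix (Fin d) (Fin d) ℂ) ρ *ᵥ w i) *
        (star (w i) ⬝ᵥ conjMap (R g : Matrix (Fin d) (Fin d) ℂ) X *ᵥ w i) := by
  rw [twirl_apply, Finset.mul_sum, trace_sum]
  refine Finset.sum_congr rfl fun g _ => ?_
  have h : ∀ Z, (ρ * conjMap (R g⁻¹ : Matrix (Fin d) (Fin d) ℂ) Z).trace =
      (conjMap (R g : Matrix (Fin d) (Fin d) ℂ) ρ * Z).trace := by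
    intro Z
    rw [conjMap_apply, conjMap_apply, star_rep_coe, star_rep_coe, inv_inv,
      ← mul_assoc, Matrix.trace_mul_comm]
    simp only [mul_assoc]
  rw [h, dephase_apply, Finset.mul_sum, trace_sum]
  refine Finset.sum_congr rfl fun i _ => ?_
  rw [rankOne_mul_mul_rankOne, mul_smul_comm, trace_smul, trace_mul_rankOne, smul_eq_mul, mul_comm]

theorem posSemidef_conjMap {X : Matrix (Fin d) (Fin d) ℂ} (hX : X.PosSemidef)
    (A : Matrix (Fin d) (Fin d) ℂ) : (conjMap A X).PosSemidef := by
  rw [conjMap_apply]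
  exact hX.mul_mul_conjTranspose_same A

theorem est_eq_re (Y : Matrix (Fin d) (Fin d) ℂ) (g : G) (i : Fin d) :
    est R w Y g i =
      (star (w i) ⬝ᵥ conjMap (R g : Matrix (Fin d) (Fin d) ℂ) Y *ᵥ w i).re := by
  rw [conjMap_apply]; rfl

theorem prob_eq_est (ρ : Matrix (Fin d) (Fin d) ℂ) (g : G) (i : Fin d) :
    prob R w ρ g i = (Fintype.card G : ℝ)⁻¹ * est R w ρ g i := by
  rw [prob, est, ← Complex.ofReal_natCast, ← Complex.ofReal_inv, Complex.re_ofReal_mul]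

theorem est_sub (X Y : Matrix (Fin d) (Fin d) ℂ) (g : G) (i : Fin d) :
    est R w (X - Y) g i = est R w X g i - est R w Y g i := by
  simp only [est_eq_re, map_sub, sub_mulVec, dotProduct_sub, Complex.sub_re]

theorem est_ofReal_smul (r : ℝ) (Y : Matrix (Fin d) (Fin d) ℂ) (g : G) (i : Fin d) :
    est R w ((r : ℂ) • Y) g i = r * est R w Y g i := by
  simp only [est_eq_re, map_smul, smul_mulVec, dotProduct_smul, smul_eq_mul,
    Complex.re_ofReal_mul]

theorem est_one (horth : ∀ i j, (∑ x, star (w i x) * w j x) = if i = j then 1 else 0)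
    (g : G) (i : Fin d) : est R w 1 g i = 1 := by
  have h : star (w i) ⬝ᵥ w i = 1 := (horth i i).trans (if_pos rfl)
  rw [est_eq_re, conjMap_apply, mul_one, star_rep_coe, rep_coe_mul_rep_coe]
  simp [h]

theorem ofReal_est {Y : Matrix (Fin d) (Fin d) ℂ} (hY : Y.PosSemidef) (g : G) (i : Fin d) :
    (est R w Y g i : ℂ) =
      star (w i) ⬝ᵥ conjMap (R g : Matrix (Fin d) (Fin d) ℂ) Y *ᵥ w i := by
  rw [est_eq_re]
  exact Complex.ext rfl
    (Complex.nonneg_iff.1 ((posSemidef_conjMap hY _).dotProduct_mulVec_nonneg (w i))).2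

theorem est_nonneg {Y : Matrix (Fin d) (Fin d) ℂ} (hY : Y.PosSemidef) (g : G) (i : Fin d) :
    0 ≤ est R w Y g i := by
  have h := (posSemidef_conjMap hY (R g : Matrix (Fin d) (Fin d) ℂ)).dotProduct_mulVec_nonneg (w i)
  rw [← ofReal_est R w hY] at h
  exact_mod_cast h

theorem prob_nonneg {ρ : Matrix (Fin d) (Fin d) ℂ} (hρ : ρ.PosSemidef) (g : G) (i : Fin d) :
    0 ≤ prob R w ρ g i := by
  rw [prob_eq_est]
  exact mul_nonneg (by positivity) (est_nonneg R w hρ g i)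

theorem est_le_opNorm (horth : ∀ i j, (∑ x, star (w i x) * w j x) = if i = j then 1 else 0)
    {Y : Matrix (Fin d) (Fin d) ℂ} (hY : Y.IsHermitian) (g : G) (i : Fin d) :
    est R w Y g i ≤ opNorm Y := by
  have h := est_nonneg R w (posSemidef_opNorm_smul_one_sub hY) g i
  rw [est_sub, est_ofReal_smul, est_one R w horth] at h
  linarith

theorem ofReal_mean {ρ Y : Matrix (Fin d) (Fin d) ℂ} (hρ : ρ.PosSemidef) (hY : Y.PosSemidef) :
    (mean R w ρ Y : ℂ) = (Fintype.card G : ℂ)⁻¹ * (ρ * twirl R w Y).trace := by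
  rw [trace_mul_twirl, mean, Finset.mul_sum]
  push_cast
  refine Finset.sum_congr rfl fun g _ => ?_
  rw [Finset.mul_sum]
  refine Finset.sum_congr rfl fun i _ => ?_
  rw [prob_eq_est, ← ofReal_est R w hρ, ← ofReal_est R w hY]
  push_cast
  ring

theorem variance_neg (ρ Y : Matrix (Fin d) (Fin d) ℂ) :
    variance R w ρ (-Y) = variance R w ρ Y := by
  have h : ∀ g i, est R w (-Y) g i = -est R w Y g i := fun g i => by
    simpa using est_ofReal_smul R w (-1) Y g i
  simp [variance, mean, h]

theorem variance_inv_smul_le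
    (horth : ∀ i j, (∑ x, star (w i x) * w j x) = if i = j then 1 else 0)
    {a : ℝ} (ha : 0 < a) {ρ Y : Matrix (Fin d) (Fin d) ℂ} (hρ : ρ.PosSemidef)
    (hρtr : ρ.trace = 1) (hY : Y.PosSemidef) (hmean : mean R w ρ Y = a * (ρ * Y).trace.re) :
    variance R w ρ ((a : ℂ)⁻¹ • Y) ≤ (opNorm Y) ^ 2 / a := by
  have htr : (ρ * Y).trace.re ≤ opNorm Y := by
    have h := trace_mul_nonneg_of_posSemidef hρ (posSemidef_opNorm_smul_one_sub hY.1)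
    rw [mul_sub, mul_smul_comm, mul_one, trace_sub, trace_smul, hρtr] at h
    simpa using (Complex.nonneg_iff.1 h).1
  have hnorm : 0 ≤ opNorm Y := norm_nonneg _
  have hterm : ∀ g i, prob R w ρ g i * est R w ((a : ℂ)⁻¹ • Y) g i ^ 2 ≤
      a⁻¹ ^ 2 * opNorm Y * (prob R w ρ g i * est R w Y g i) := by
    intro g i
    rw [← Complex.ofReal_inv, est_ofReal_smul]
    have h := mul_le_mul_of_nonneg_left (est_le_opNorm R w horth hY.1 g i)
      (mul_nonneg (sq_nonneg a⁻¹)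
        (mul_nonneg (prob_nonneg R w hρ g i) (est_nonneg R w hY g i)))
    linarith
  calc variance R w ρ ((a : ℂ)⁻¹ • Y)
      ≤ ∑ g : G, ∑ i, prob R w ρ g i * est R w ((a : ℂ)⁻¹ • Y) g i ^ 2 :=
        sub_le_self _ (sq_nonneg _)
    _ ≤ ∑ g : G, ∑ i, a⁻¹ ^ 2 * opNorm Y * (prob R w ρ g i * est R w Y g i) :=
        Finset.sum_le_sum fun g _ => Finset.sum_le_sum fun i _ => hterm g i
    _ = a⁻¹ ^ 2 * opNorm Y * mean R w ρ Y := by simp only [mean, Finset.mul_sum]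
    _ = a⁻¹ * opNorm Y * (ρ * Y).trace.re := by rw [hmean]; field_simp
    _ ≤ a⁻¹ * opNorm Y * opNorm Y := by gcongr
    _ = (opNorm Y) ^ 2 / a := by ring

theorem twirl_eq_smul (W F : Submodule ℂ (Matrix (Fin d) (Fin d) ℂ)) (hW : W ≠ ⊥)
    (hWinv : ∀ (g : G), ∀ X ∈ W, conjMap (R g : Matrix (Fin d) (Fin d) ℂ) X ∈ W)
    (hWirr : ∀ W' : Submodule ℂ (Matrix (Fin d) (Fin d) ℂ), W' ≤ W →
      (∀ (g : G), ∀ X ∈ W', conjMap (R g : Matrix (Fin d) (Fin d) ℂ) X ∈ W') →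
      W' = ⊥ ∨ W' = W)
    (hD : ∀ X ∈ W, dephase w X ∈ W ⊓ F) (hDfix : ∀ X ∈ W ⊓ F, dephase w X = X)
    {X : Matrix (Fin d) (Fin d) ℂ} (hX : X ∈ W) :
    (Fintype.card G : ℂ)⁻¹ • twirl R w X =
      ((Module.finrank ℂ ↥(W ⊓ F) : ℂ) / Module.finrank ℂ W) • X := by
  have hT : ∀ X ∈ W, twirl R w X ∈ W := fun X hX => by
    rw [twirl_apply]
    exact Submodule.sum_mem _ fun g _ => hWinv _ _ (hD _ (hWinv _ _ hX)).1
  obtain ⟨c, hc⟩ := exists_scalar_of_irreducible W hW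
    (fun g => conjMap (R g : Matrix (Fin d) (Fin d) ℂ)) hWinv hWirr (twirl R w) hT
    (fun g X _ => twirl_conjMap R w g X)
  have hr : (twirl R w).restrict hT = c • LinearMap.id :=
    LinearMap.ext fun X => Subtype.ext (hc X X.2)
  have htr : LinearMap.trace ℂ W ((twirl R w).restrict hT) =
      Fintype.card G * Module.finrank ℂ ↥(W ⊓ F) := by
    have hsum : (twirl R w).restrict hT = ∑ g : G,
        (conjMap (R g⁻¹ : Matrix (Fin d) (Fin d) ℂ)).restrict (hWinv g⁻¹) ∘ₗ
          ((dephase w).restrict fun x hx => (hD x hx).1) ∘ₗ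
            (conjMap (R g : Matrix (Fin d) (Fin d) ℂ)).restrict (hWinv g) := by
      refine LinearMap.ext fun X => Subtype.ext ?_
      simp [twirl_apply]
    have hterm : ∀ g : G, LinearMap.trace ℂ W
        ((conjMap (R g⁻¹ : Matrix (Fin d) (Fin d) ℂ)).restrict (hWinv g⁻¹) ∘ₗ
          ((dephase w).restrict fun x hx => (hD x hx).1) ∘ₗ
            (conjMap (R g : Matrix (Fin d) (Fin d) ℂ)).restrict (hWinv g)) =
        Module.finrank ℂ ↥(W ⊓ F) := by
      intro g
      rw [LinearMap.trace_comp_comm', LinearMap.comp_assoc,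
        show (conjMap (R g : Matrix (Fin d) (Fin d) ℂ)).restrict (hWinv g) ∘ₗ
          (conjMap (R g⁻¹ : Matrix (Fin d) (Fin d) ℂ)).restrict (hWinv g⁻¹) = LinearMap.id from
          LinearMap.ext fun X => Subtype.ext (by
            rw [LinearMap.comp_apply, LinearMap.coe_restrict_apply, LinearMap.coe_restrict_apply,
              conjMap_rep_conjMap_rep, mul_inv_cancel, map_one]
            exact conjMap_one _),
        LinearMap.comp_id, trace_restrict_of_isProj W F (dephase w) hD hDfix]
    rw [hsum, map_sum, Finset.sum_congr rfl fun g _ => hterm g]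
    simp
  rw [hr, map_smul, LinearMap.trace_id, smul_eq_mul] at htr
  have hWpos : (Module.finrank ℂ W : ℂ) ≠ 0 := by
    rw [Nat.cast_ne_zero, Ne, Submodule.finrank_eq_zero]
    exact hW
  have hG : (Fintype.card G : ℂ) ≠ 0 := by simp
  rw [hc X hX, smul_smul]
  congr 1
  field_simp
  linear_combination htr

theorem dephase_mem_inf_and_eq_self {m : ℕ} {w : Fin d → Fin d → ℂ}
    (P : Fin m → Matrix (Fin d) (Fin d) ℂ) (hPsa : ∀ k, (P k)ᴴ = P k)
    (hPorth : ∀ k l, k ≠ l → P k * P l = 0)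
    (horth : ∀ i j, (∑ x, star (w i x) * w j x) = if i = j then 1 else 0)
    (k : Fin d → Fin m) (hadapt : ∀ i, (P (k i)).mulVec (w i) = w i)
    (H : Subgroup G) (χ : Fin d → H → ℂ)
    (heig : ∀ (h : H) (i : Fin d),
      ((R (h : G) : Matrix (Fin d) (Fin d) ℂ)).mulVec (w i) = χ i h • w i)
    (hnd : ∀ i j, i ≠ j → k i = k j → χ i ≠ χ j)
    (W : Submodule ℂ (Matrix (Fin d) (Fin d) ℂ))
    (hWinv : ∀ (g : G), ∀ X ∈ W, conjMap (R g : Matrix (Fin d) (Fin d) ℂ) X ∈ W)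
    (hWdiag : ∀ X ∈ W, ∀ l, P l * X * P l = X * P l) :
    (∀ X ∈ W, dephase w X ∈ W ⊓ ⨅ h : H, LinearMap.ker
        (conjMap ((R (h : G) : Matrix (Fin d) (Fin d) ℂ)) - LinearMap.id)) ∧
    ∀ X ∈ W ⊓ ⨅ h : H, LinearMap.ker
        (conjMap ((R (h : G) : Matrix (Fin d) (Fin d) ℂ)) - LinearMap.id),
      dephase w X = X := by
  have hmem : ∀ X, X ∈ W ⊓ ⨅ h : H, LinearMap.ker
        (conjMap ((R (h : G) : Matrix (Fin d) (Fin d) ℂ)) - LinearMap.id) ↔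
      X ∈ W ∧ ∀ h : H, conjMap ((R (h : G) : Matrix (Fin d) (Fin d) ℂ)) X = X := by
    intro X; simp [sub_eq_zero]
  have hPr : ∀ i, P (k i) * rankOne (w i) = rankOne (w i) := fun i => by
    simpa using mul_rankOne_of_mulVec_eq (c := 1) (by simpa using hadapt i)
  have hrP : ∀ i, rankOne (w i) * P (k i) = rankOne (w i) := fun i => by
    simpa [star_rankOne, star_eq_conjTranspose (P _), hPsa] using congrArg star (hPr i)
  have hfix : ∀ X ∈ W, (∀ h : H, conjMap ((R (h : G) : Matrix (Fin d) (Fin d) ℂ)) X = X) →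
      dephase w X = X := by
    intro X hX hXH
    refine dephase_eq_self horth fun i j hij => ?_
    by_cases hk : k i = k j
    · obtain ⟨h, hh⟩ := Function.ne_iff.1 (hnd i j hij hk)
      have hcomm : (R (h : G) : Matrix (Fin d) (Fin d) ℂ) * X =
          X * (R (h : G) : Matrix (Fin d) (Fin d) ℂ) := by
        conv_rhs => rw [← hXH h]
        rw [conjMap_apply, star_rep_coe, mul_assoc _ _ (R (h : G)).1, rep_coe_mul_rep_coe]
        simp
      have h1 : χ i h • (rankOne (w i) * X * rankOne (w j)) =
          χ j h • (rankOne (w i) * X * rankOne (w j)) := by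
        rw [← smul_mul_assoc, ← smul_mul_assoc, ← rankOne_mul_of_eigenbasis horth (heig h),
          mul_assoc _ _ X, hcomm, ← mul_smul_comm, ← mul_rankOne_of_mulVec_eq (heig h j)]
        simp only [mul_assoc]
      rw [← sub_eq_zero, ← sub_smul] at h1
      exact (smul_eq_zero.1 h1).resolve_left (sub_ne_zero.2 hh)
    · calc rankOne (w i) * X * rankOne (w j)
          = rankOne (w i) * P (k i) * (X * P (k j)) * rankOne (w j) := by
            rw [hrP, ← mul_assoc, mul_assoc _ (P _), hPr]
        _ = rankOne (w i) * (P (k i) * P (k j)) * X * P (k j) * rankOne (w j) := by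
            rw [← hWdiag X hX]; simp only [mul_assoc]
        _ = 0 := by simp [hPorth _ _ hk]
  refine ⟨fun X hX => ?_, fun X hX => hfix X ((hmem X).1 hX).1 ((hmem X).1 hX).2⟩
  classical
  set S := ∑ h : H, conjMap ((R (h : G) : Matrix (Fin d) (Fin d) ℂ)) X with hS
  have hSW : S ∈ W := Submodule.sum_mem _ fun h _ => hWinv _ _ hX
  have hSH : ∀ h : H, conjMap ((R (h : G) : Matrix (Fin d) (Fin d) ℂ)) S = S := by
    intro h
    rw [hS, map_sum]
    refine Fintype.sum_equiv (Equiv.mulLeft h) _ _ fun h' => ?_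
    simp [conjMap_rep_conjMap_rep]
  have hDS : dephase w S = (Fintype.card H : ℂ) • dephase w X := by
    rw [hS, map_sum, Finset.sum_congr rfl fun h _ => dephase_conjMap_of_eigenbasis horth
      (by rw [star_rep_coe, rep_coe_mul_rep_coe]; simp) (heig h) X]
    simp [Nat.cast_smul_eq_nsmul]
  have hDX : dephase w X = (Fintype.card H : ℂ)⁻¹ • S := by
    rw [← hfix S hSW hSH, hDS, smul_smul, inv_mul_cancel₀ (by simp), one_smul]
  rw [hDX]
  exact Submodule.smul_mem _ _ ((hmem S).2 ⟨hSW, hSH⟩)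

end Twirl

/-- In the NDCSE setting, let `W ⊆ End(V)` be conjugation-invariant,
irreducible and block-preserving, with visibility coefficient `a = dim(W^H)/dim(W) > 0`.
If `O ∈ W` is positive or negative semidefinite, then the estimator with `Y = a⁻¹ O`
satisfies `Var[ô] ≤ ‖O‖_∞² / a` for every density matrix `ρ`. -/
theorem shadow_variance_semidefinite_bound
    (G : Type*) [Group G] [Fintype G] (d m : ℕ)
    (R : G →* Matrix.unitaryGroup (Fin d) ℂ)
    -- the orthogonal projections onto the summands V_1, ..., V_m
    (P : Fin m → Matrix (Fin d) (Fin d) ℂ)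
    (hPproj : ∀ k, P k * P k = P k)
    (hPsa : ∀ k, (P k)ᴴ = P k)
    (hPorth : ∀ k l, k ≠ l → P k * P l = 0)
    (hPsum : ∑ k, P k = 1)
    (hPinv : ∀ (g : G) k, (R g : Matrix (Fin d) (Fin d) ℂ) * P k
        = P k * (R g : Matrix (Fin d) (Fin d) ℂ))
    -- each summand is irreducible as a G-module
    (hirr : ∀ k (Q : Matrix (Fin d) (Fin d) ℂ), Q * Q = Q → Qᴴ = Q →
        Q * P k = Q → P k * Q = Q →
        (∀ g : G, (R g : Matrix (Fin d) (Fin d) ℂ) * Q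
          = Q * (R g : Matrix (Fin d) (Fin d) ℂ)) →
        Q = 0 ∨ Q = P k)
    -- an orthonormal basis adapted to the decomposition
    (w : Fin d → Fin d → ℂ)
    (horth : ∀ i j, (∑ x, star (w i x) * w j x) = if i = j then 1 else 0)
    (k : Fin d → Fin m)
    (hadapt : ∀ i, (P (k i)).mulVec (w i) = w i)
    -- an abelian subgroup H of G for which w is a non-degenerate simultaneous eigenbasis
    (H : Subgroup G)
    (hHab : ∀ a b : H, a * b = b * a)
    (χ : Fin d → H → ℂ)
    (heig : ∀ (h : H) (i : Fin d),
      ((R (h : G) : Matrix (Fin d) (Fin d) ℂ)).mulVec (w i) = χ i h • w i)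
    (hnd : ∀ i j, i ≠ j → k i = k j → χ i ≠ χ j)
    -- the operator subspace W: conjugation-invariant, irreducible, block-preserving
    (W : Submodule ℂ (Matrix (Fin d) (Fin d) ℂ))
    (hWinv : ∀ (g : G), ∀ X ∈ W, conjMap (R g : Matrix (Fin d) (Fin d) ℂ) X ∈ W)
    (hWirr : ∀ W' : Submodule ℂ (Matrix (Fin d) (Fin d) ℂ), W' ≤ W →
      (∀ (g : G), ∀ X ∈ W', conjMap (R g : Matrix (Fin d) (Fin d) ℂ) X ∈ W') →
      W' = ⊥ ∨ W' = W)
    (hWdiag : ∀ X ∈ W, ∀ l, P l * X * P l = X * P l)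
    -- the visibility coefficient a = dim W^H / dim W, positive
    (a : ℝ)
    (ha : a =
      (Module.finrank ℂ
        ↥(W ⊓ ⨅ h : H, LinearMap.ker
            (conjMap ((R (h : G) : Matrix (Fin d) (Fin d) ℂ)) - LinearMap.id)) : ℝ) /
      (Module.finrank ℂ ↥W : ℝ))
    (hapos : 0 < a)
    -- the observable O ∈ W, positive or negative semidefinite
    (O : Matrix (Fin d) (Fin d) ℂ)
    (hOmem : O ∈ W)
    (hOdef : O.PosSemidef ∨ (-O).PosSemidef)
    -- a density matrix
    (ρ : Matrix (Fin d) (Fin d) ℂ)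
    (hρ : ρ.PosSemidef) (hρtr : ρ.trace = 1) :
    variance R w ρ (((a : ℂ))⁻¹ • O) ≤ (opNorm O) ^ 2 / a := by
  obtain ⟨hD, hDfix⟩ := dephase_mem_inf_and_eq_self R P hPsa hPorth horth k hadapt H χ heig hnd W
    hWinv hWdiag
  have hW : W ≠ ⊥ := by
    rintro rfl
    simp [ha] at hapos
  have hmean : ∀ Y ∈ W, Y.PosSemidef → mean R w ρ Y = a * (ρ * Y).trace.re := by
    intro Y hY hYpos
    have h := ofReal_mean R w hρ hYpos
    rw [← smul_eq_mul, ← trace_smul, ← mul_smul_comm,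
      twirl_eq_smul R w W _ hW hWinv hWirr hD hDfix hY, mul_smul_comm, trace_smul,
      smul_eq_mul] at h
    have h' := congrArg Complex.re h
    rw [Complex.ofReal_re] at h'
    rw [h', ha, ← Complex.re_ofReal_mul]
    push_cast
    rfl
  rcases hOdef with hO | hO
  · exact variance_inv_smul_le R w horth hapos hρ hρtr hO (hmean O hOmem hO)
  · have h := variance_inv_smul_le R w horth hapos hρ hρtr hO
      (hmean (-O) (W.neg_mem hOmem) hO)
    rw [smul_neg, variance_neg] at h
    simpa only [opNorm, map_neg, norm_neg] using h
end
end
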